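/- Let rho in {1,2}^Z be the bi-infinite sequence determined by: (rho_0, rho_1, rho_2, ...) is the periodic repetition of the block 2_4 1_2 2_2 1, and (rho_{-1}, rho_{-2}, rho_{-3}, ...) = 1, 2_2, 1_2, 2_4, 1, 2_2, 1_2, 2_2, 1_2, followed by the periodic repetition of the block 2_3 1_3. Then lambda_j(rho) < lambda_0(rho) for every j different from 0; consequently m(rho) = lambda_0(rho) = f and f belongs to the Markov spectrum M, where f := [overline(2_4 1_2 2_2 1)] + [0; 1, 2_2, 1_2, 2_4, 1, 2_2, 1_2, 2_2, 1_2, overline(2_3 1_3)]. -/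

import Mathlib

open Filter Set

/-- Convergents of the continued fraction `[a 0; a 1, a 2, ...]`. -/
noncomputable def cfConv : (ℕ → ℕ) → ℕ → ℝ
  | a, 0 => (a 0 : ℝ)
  | a, n + 1 => (a 0 : ℝ) + 1 / cfConv (fun i => a (i + 1)) n

/-- Value of the infinite continued fraction `[a 0; a 1, a 2, ...]`,
i.e. the limit of its convergents. -/
noncomputable def cfVal (a : ℕ → ℕ) : ℝ := limUnder atTop (cfConv a)

/-- Value of the infinite continued fraction `[0; g 0, g 1, g 2, ...]`. -/
noncomputable def cf0 (g : ℕ → ℕ) : ℝ :=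
  cfVal (fun n => match n with | 0 => 0 | k + 1 => g k)

/-- `λ_i(A) = [a_i; a_{i+1}, ...] + [0; a_{i-1}, a_{i-2}, ...]` for a bi-infinite
sequence `A`. -/
noncomputable def lam (A : ℤ → ℕ) (i : ℤ) : ℝ :=
  cfVal (fun n => A (i + n)) + cf0 (fun k => A (i - 1 - k))

/-- The Markov value `m(A) = sup_i λ_i(A)`. -/
noncomputable def markovVal (A : ℤ → ℕ) : ℝ := sSup (Set.range (lam A))

/-- The Lagrange value `ℓ(A) = limsup_{i → +∞} λ_i(A)`. -/
noncomputable def lagrangeVal (A : ℤ → ℕ) : ℝ := limsup (lam A) atTop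

/-- The Markov spectrum (Perron's characterization). -/
def MarkovSpectrum : Set ℝ :=
  {x | ∃ A : ℤ → ℕ, (∀ n, 0 < A n) ∧ BddAbove (Set.range (lam A)) ∧ x = markovVal A}

/-- The Lagrange spectrum (Perron's characterization). -/
def LagrangeSpectrum : Set ℝ :=
  {x | ∃ A : ℤ → ℕ, (∀ n, 0 < A n) ∧ IsBoundedUnder (· ≤ ·) atTop (lam A) ∧
    x = lagrangeVal A}

/-- The purely periodic one-sided sequence with period `w`. -/
def perSeq (w : List ℕ) : ℕ → ℕ := fun n => w.getD (n % w.length) 1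

/-- The one-sided sequence beginning with the finite word `p` and continuing with `g`. -/
def catSeq (p : List ℕ) (g : ℕ → ℕ) : ℕ → ℕ :=
  fun n => if n < p.length then p.getD n 1 else g (n - p.length)

/-- The eventually periodic one-sided sequence with preperiod `p` and period `w`. -/
def prePer (p w : List ℕ) : ℕ → ℕ := catSeq p (perSeq w)

/-- The periodic bi-infinite sequence with period `w`. -/
def perZ (w : List ℕ) : ℤ → ℕ := fun n => w.getD ((n % (w.length : ℤ)).toNat) 1

/-- `c_∞ = [overline(2_4 1_2 2_2 1)] + [0; overline(1 2_2 1_2 2_4)]`. -/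
noncomputable def cInf : ℝ :=
  cfVal (perSeq [2,2,2,2,1,1,2,2,1]) + cf0 (perSeq [1,2,2,1,1,2,2,2,2])

/-- `C_∞ = [2; 1, 2_2, 1_2, 2_4, 1, 2_2, 1_2, 2_4, 1, 2_2, 1_2, 2_2, 1, 2_4, 1_2,
overline(2_3 1_3)] + [0; 2_3, 1_2, 2_2, 1, 2_4, 1, overline(1_3 2_3)]`. -/
noncomputable def CInf : ℝ :=
  cfVal (prePer [2,1,2,2,1,1,2,2,2,2,1,2,2,1,1,2,2,2,2,1,2,2,1,1,2,2,1,2,2,2,2,1,1]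
    [2,2,2,1,1,1]) +
  cf0 (prePer [2,2,2,1,1,2,2,1,2,2,2,2,1] [1,1,1,2,2,2])

/-- `f = [overline(2_4 1_2 2_2 1)] + [0; 1, 2_2, 1_2, 2_4, 1, 2_2, 1_2, 2_2, 1_2,
overline(2_3 1_3)]`. -/
noncomputable def fV : ℝ :=
  cfVal (perSeq [2,2,2,2,1,1,2,2,1]) +
  cf0 (prePer [1,2,2,1,1,2,2,2,2,1,2,2,1,1,2,2,1,1] [2,2,2,1,1,1])

/-- `w` occurs in the bi-infinite sequence `A` starting at position `j`. -/
def occursAtZ (w : List ℕ) (A : ℤ → ℕ) (j : ℤ) : Prop :=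
  ∀ i : ℕ, i < w.length → A (j + i) = w.getD i 0

/-- `w` occurs somewhere in the bi-infinite sequence `A`. -/
def occursInZ (w : List ℕ) (A : ℤ → ℕ) : Prop := ∃ j : ℤ, occursAtZ w A j

/-- `w` occurs in the one-sided sequence `g` starting at position `k`. -/
def occursAtN (w : List ℕ) (g : ℕ → ℕ) (k : ℕ) : Prop :=
  ∀ i : ℕ, i < w.length → g (k + i) = w.getD i 0

/-- `w` occurs somewhere in the one-sided sequence `g`. -/
def occursInN (w : List ℕ) (g : ℕ → ℕ) : Prop := ∃ k : ℕ, occursAtN w g k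

def W1 : List ℕ := [1,2,1]
def W2 : List ℕ := [2,2,1,2,2,2,1]
def W3 : List ℕ := [2,2,2,1,2,2,2]
def W4 : List ℕ := [2,2,2,2,2,1,2,2,1,1]
def W5 : List ℕ := [2,2,2,1,1,2,2,2,2,1,2,2,1,1,2,2,2]
def W6 : List ℕ := [2,2,1,1,2,2,2,2,1,2,2,1,1,2,2,2,1]
def W7 : List ℕ := [1,1,2,2,1,1,2,2,2,2,1,2,2,1,1,2,2,2]
def W8 : List ℕ := [2,2,1,2,2,1,1,2,2,2,2,1,2,2,1,1,2,2,2,2,2]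
def W9 : List ℕ := [1,2,2,1,2,2,1,1,2,2,2,2,1,2,2,1,1,2,2,2,2,1]
def W10 : List ℕ := [2,2,2,2,1,2,2,1,1,2,2,2,2,1,2,2,1,1,2,2,2,2,1,1]
def W11 : List ℕ := [2,2,2,2,1,2,2,1,1,2,2,2,2,1,2,2,1,1,2,2,2,2,1,2,2,1,2]
def W12 : List ℕ := [1,2,2,2,2,1,2,2,1,1,2,2,2,2,1,2,2,1,1,2,2,2,2,1,2,2,1,1,1]
def W13 : List ℕ := [2,1,2,2,2,2,1,2,2,1,1,2,2,2,2,1,2,2,1,1,2,2,2,2,1,2,2,1,1,2,2]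

/-- The list of the thirteen words `W_1, …, W_13`. -/
def Wall : List (List ℕ) := [W1,W2,W3,W4,W5,W6,W7,W8,W9,W10,W11,W12,W13]

/-- The words `W_1, …, W_13` together with the (0-based) position of their marked
digit `2^*`. -/
def markedW : List (List ℕ × ℕ) :=
  [(W1,1),(W2,3),(W3,4),(W4,4),(W5,8),(W6,7),(W7,9),(W8,10),(W9,11),(W10,12),
   (W11,12),(W12,13),(W13,14)]

/-- The words `V_15, …, V_21` together with the (0-based) position of their marked
digit `2^*`. -/
def markedV : List (List ℕ × ℕ) :=
  [([1,1,2,2],2),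
   ([2,2,1,2,2,1],3),
   ([2,2,2,2,1,2,2,1,2],3),
   ([1,2,2,2,2,1,2,2,1,1,1],4),
   ([1,2,2,2,2,1,2,2,1,1,2,2,1],4),
   ([2,1,2,2,2,2,1,2,2,1,1,2,2,2],5),
   ([1,1,1,2,2,2,2,1,2,2,1,1,2,2,2],6)]

/-- The word `2 1_2 2_4 1 2_2 1_2 2_3`. -/
def spWord : List ℕ := [2,1,1,2,2,2,2,1,2,2,1,1,2,2,2]

/-- The set `P` of 27 forbidden words: `W_1, …, W_13`, their transposes, and
`2 1_2 2_4 1 2_2 1_2 2_3` together with its transpose. -/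
def Pwords : List (List ℕ) := Wall ++ Wall.map List.reverse ++ [spWord, spWord.reverse]

/-- `g` contains no word of `P` as a consecutive subword. -/
def avoidsP (g : ℕ → ℕ) : Prop := ∀ w ∈ Pwords, ¬ occursInN w g

/-- The Cantor set `Y`. -/
noncomputable def Yset : Set ℝ :=
  {x | ∃ g : ℕ → ℕ, (∀ n, g n = 1 ∨ g n = 2) ∧ avoidsP g ∧ x = cf0 g}

/-- The word `1_2 2_4 1 2_2 1_2 2_4 1 2_2 1_2 2_4 1 2_2 1_2 2_2`. -/
def bigWord : List ℕ :=
  [1,1,2,2,2,2,1,2,2,1,1,2,2,2,2,1,2,2,1,1,2,2,2,2,1,2,2,1,1,2,2]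

/-- The word `1_3 2_4 1 2_2 1_2 2_4 1 2_2 1_2 2_4 1 2_2 1_2 2_2`. -/
def bigWord13 : List ℕ := 1 :: bigWord

/-- `g` is an infinite concatenation of the blocks `(1,1)` and `(2,2)`. -/
def isBlockSeq (g : ℕ → ℕ) : Prop :=
  ∀ n, (g (2*n) = 1 ∧ g (2*n+1) = 1) ∨ (g (2*n) = 2 ∧ g (2*n+1) = 2)

/-- The Gauss–Cantor set `K({1_2, 2_2})`. -/
noncomputable def Kset : Set ℝ := {x | ∃ g : ℕ → ℕ, isBlockSeq g ∧ x = cf0 g}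

/-- The bi-infinite sequence `ρ = overline(1 2_2 1_2 2_4); overline(2_4 1_2 2_2 1)`
with prefix to the left of position `0` as in Freiman's construction. -/
noncomputable def rho : ℤ → ℕ := fun n =>
  if 0 ≤ n then perSeq [2,2,2,2,1,1,2,2,1] n.toNat
  else prePer [1,2,2,1,1,2,2,2,2,1,2,2,1,1,2,2,1,1] [2,2,2,1,1,1] (-n - 1).toNat

/-- All terms of `a` are `1` or `2`. -/
def OneTwo (a : ℕ → ℕ) : Prop := ∀ n, 1 ≤ a n ∧ a n ≤ 2

lemma OneTwo.shift {a : ℕ → ℕ} (ha : OneTwo a) : OneTwo (fun i => a (i + 1)) :=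
  fun n => ha (n + 1)

lemma cfConv_mem_Icc {a : ℕ → ℕ} (ha : OneTwo a) (n : ℕ) : cfConv a n ∈ Icc (1 : ℝ) 3 := by
  induction n generalizing a with
  | zero =>
    have h1 : (1 : ℝ) ≤ a 0 := by exact_mod_cast (ha 0).1
    have h2 : (a 0 : ℝ) ≤ 2 := by exact_mod_cast (ha 0).2
    exact ⟨h1, by simp only [cfConv]; linarith⟩
  | succ n ih =>
    have h1 : (1 : ℝ) ≤ a 0 := by exact_mod_cast (ha 0).1
    have h2 : (a 0 : ℝ) ≤ 2 := by exact_mod_cast (ha 0).2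
    obtain ⟨h3, -⟩ := ih ha.shift
    have h4 : 0 ≤ 1 / cfConv (fun i => a (i + 1)) n := by positivity
    have h5 : 1 / cfConv (fun i => a (i + 1)) n ≤ 1 := by
      rw [div_le_one (by linarith)]; exact h3
    simp only [cfConv]
    exact ⟨by linarith, by linarith⟩

lemma dist_cfConv_succ_le {a : ℕ → ℕ} (ha : OneTwo a) (n : ℕ) :
    dist (cfConv a n) (cfConv a (n + 1)) ≤ 1 * (3 / 4) ^ n := by
  induction n generalizing a with
  | zero =>
    have h3 := (cfConv_mem_Icc ha.shift 0).1
    have h5 : 1 / cfConv (fun i => a (i + 1)) 0 ≤ 1 := by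
      rw [div_le_one (by linarith)]; exact h3
    rw [Real.dist_eq, abs_sub_comm]
    simp only [cfConv, add_sub_cancel_left, pow_zero, mul_one] at h3 h5 ⊢
    rw [abs_of_nonneg (by positivity)]
    exact h5
  | succ n ih =>
    have hd := ih ha.shift
    have h1 := (cfConv_mem_Icc ha.shift n).1
    have h2 : 4 / 3 ≤ cfConv (fun i => a (i + 1)) (n + 1) := by
      obtain ⟨h3, h4⟩ := cfConv_mem_Icc ha.shift.shift n
      have h5 : (1 : ℝ) ≤ a 1 := by exact_mod_cast (ha 1).1
      have h6 : 1 / 3 ≤ 1 / cfConv (fun i => a (i + 1 + 1)) n :=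
        one_div_le_one_div_of_le (by linarith) h4
      simp only [cfConv, zero_add]
      linarith
    rw [Real.dist_eq] at hd ⊢
    rw [cfConv, cfConv, add_sub_add_left_eq_sub]
    set x := cfConv (fun i => a (i + 1)) n
    set y := cfConv (fun i => a (i + 1)) (n + 1)
    have hxy : 4 / 3 ≤ x * y := by nlinarith
    rw [div_sub_div _ _ (by linarith) (by linarith), abs_div, abs_of_pos (by linarith : 0 < x * y),
      div_le_iff₀ (by linarith), one_mul, mul_one, abs_sub_comm]
    have hp : (0 : ℝ) ≤ (3 / 4) ^ n := by positivity
    rw [pow_succ]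
    nlinarith

lemma tendsto_cfConv {a : ℕ → ℕ} (ha : OneTwo a) :
    Tendsto (cfConv a) atTop (nhds (cfVal a)) :=
  (cauchySeq_of_le_geometric (3 / 4) 1 (by norm_num) (dist_cfConv_succ_le ha)).tendsto_limUnder

lemma cfVal_mem_Icc {a : ℕ → ℕ} (ha : OneTwo a) : cfVal a ∈ Icc (1 : ℝ) 3 :=
  isClosed_Icc.mem_of_tendsto (tendsto_cfConv ha) (Eventually.of_forall (cfConv_mem_Icc ha))

lemma cfVal_eq_of_shift {a : ℕ → ℕ} (ha : OneTwo (fun i => a (i + 1))) :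
    cfVal a = a 0 + 1 / cfVal (fun i => a (i + 1)) := by
  have h0 : cfVal (fun i => a (i + 1)) ≠ 0 := by linarith [(cfVal_mem_Icc ha).1]
  have h : Tendsto (fun n => cfConv a (n + 1)) atTop
      (nhds (a 0 + 1 / cfVal (fun i => a (i + 1)))) :=
    (tendsto_const_nhds.div (tendsto_cfConv ha) h0).const_add _
  exact ((tendsto_add_atTop_iff_nat 1).1 h).limUnder_eq

lemma cf0_eq {g : ℕ → ℕ} (hg : OneTwo g) : cf0 g = 1 / cfVal g := by
  rw [cf0, cfVal_eq_of_shift (by exact hg)]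
  simp

/-- Rational lower and upper bounds for `[w 0; w 1, ...]` over all continuations of the word `w`
with digits `1` and `2`. -/
def cfBounds : List ℕ → ℚ × ℚ
  | [] => (1, 3)
  | d :: t => (d + 1 / (cfBounds t).2, d + 1 / (cfBounds t).1)

/-- The first `n` terms of a sequence. -/
def firstTerms (g : ℕ → ℕ) : ℕ → List ℕ
  | 0 => []
  | n + 1 => g 0 :: firstTerms (fun i => g (i + 1)) n

lemma firstTerms_congr {g h : ℕ → ℕ} {n : ℕ} (H : ∀ i < n, g i = h i) :
    firstTerms g n = firstTerms h n := by
  induction n generalizing g h with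
  | zero => rfl
  | succ n ih =>
    rw [firstTerms, firstTerms, H 0 (by omega), ih fun i hi => H (i + 1) (by omega)]

lemma cfBounds_spec {g : ℕ → ℕ} (hg : OneTwo g) (n : ℕ) :
    0 < (cfBounds (firstTerms g n)).1 ∧ ((cfBounds (firstTerms g n)).1 : ℝ) ≤ cfVal g ∧
      cfVal g ≤ (cfBounds (firstTerms g n)).2 := by
  induction n generalizing g with
  | zero => simpa [firstTerms, cfBounds] using cfVal_mem_Icc hg
  | succ n ih =>
    obtain ⟨h0, h1, h2⟩ := ih hg.shift
    have h0' : (0 : ℝ) < (cfBounds (firstTerms (fun i => g (i + 1)) n)).1 := by exact_mod_cast h0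
    have h3 : (0 : ℚ) < (cfBounds (firstTerms (fun i => g (i + 1)) n)).2 := by
      exact_mod_cast h0'.trans_le (h1.trans h2)
    have hd : (0 : ℚ) < g 0 := by exact_mod_cast (hg 0).1
    rw [cfVal_eq_of_shift hg.shift]
    simp only [firstTerms, cfBounds]
    refine ⟨by positivity, ?_, ?_⟩
    · push_cast
      gcongr
      exact h0'.trans_le h1
    · push_cast
      gcongr

/-- The digits of `A` read forward from position `j`. -/
def forwardDigits (A : ℤ → ℕ) (j : ℤ) (n : ℕ) : ℕ := A (j + n)

/-- The digits of `A` read backward from position `j - 1`. -/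
def backwardDigits (A : ℤ → ℕ) (j : ℤ) (n : ℕ) : ℕ := A (j - 1 - n)

/-- The rational upper bound for `lam A j` given by the `n` digits on each side of `j`. -/
def lamUpper (A : ℤ → ℕ) (n : ℕ) (j : ℤ) : ℚ :=
  (cfBounds (firstTerms (forwardDigits A j) n)).2 +
    1 / (cfBounds (firstTerms (backwardDigits A j) n)).1

/-- The rational lower bound for `lam A j` given by the `n` digits on each side of `j`. -/
def lamLower (A : ℤ → ℕ) (n : ℕ) (j : ℤ) : ℚ :=
  (cfBounds (firstTerms (forwardDigits A j) n)).1 +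
    1 / (cfBounds (firstTerms (backwardDigits A j) n)).2

lemma lam_eq {A : ℤ → ℕ} (hA : ∀ n, 1 ≤ A n ∧ A n ≤ 2) (j : ℤ) :
    lam A j = cfVal (forwardDigits A j) + 1 / cfVal (backwardDigits A j) := by
  rw [← cf0_eq (g := backwardDigits A j) fun n => hA _]
  rfl

lemma lam_le_lamUpper {A : ℤ → ℕ} (hA : ∀ n, 1 ≤ A n ∧ A n ≤ 2) (n : ℕ) (j : ℤ) :
    lam A j ≤ lamUpper A n j := by
  obtain ⟨-, -, h1⟩ := cfBounds_spec (g := forwardDigits A j) (fun n => hA _) n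
  obtain ⟨h2, h3, -⟩ := cfBounds_spec (g := backwardDigits A j) (fun n => hA _) n
  have h2' : (0 : ℝ) < (cfBounds (firstTerms (backwardDigits A j) n)).1 := by exact_mod_cast h2
  rw [lam_eq hA, lamUpper]
  push_cast
  gcongr

lemma lamLower_le_lam {A : ℤ → ℕ} (hA : ∀ n, 1 ≤ A n ∧ A n ≤ 2) (n : ℕ) (j : ℤ) :
    (lamLower A n j : ℝ) ≤ lam A j := by
  obtain ⟨-, h1, -⟩ := cfBounds_spec (g := forwardDigits A j) (fun n => hA _) n
  obtain ⟨-, -, h2⟩ := cfBounds_spec (g := backwardDigits A j) (fun n => hA _) n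
  have h3 := (cfVal_mem_Icc (a := backwardDigits A j) fun n => hA _).1
  rw [lam_eq hA, lamLower]
  push_cast
  gcongr

lemma lamUpper_congr {A : ℤ → ℕ} {n : ℕ} {j k : ℤ}
    (h : ∀ i : ℤ, -n ≤ i → i < n → A (j + i) = A (k + i)) : lamUpper A n j = lamUpper A n k := by
  have h1 : firstTerms (forwardDigits A j) n = firstTerms (forwardDigits A k) n :=
    firstTerms_congr fun i hi => h i (by omega) (by omega)
  have h2 : firstTerms (backwardDigits A j) n = firstTerms (backwardDigits A k) n :=
    firstTerms_congr fun i hi => by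
      have := h (-1 - i) (by omega) (by omega)
      simp only [backwardDigits]
      convert this using 2 <;> ring
  rw [lamUpper, lamUpper, h1, h2]

lemma perSeq_mem {w : List ℕ} (hw : ∀ d ∈ w, 1 ≤ d ∧ d ≤ 2) (n : ℕ) :
    1 ≤ perSeq w n ∧ perSeq w n ≤ 2 := by
  rw [perSeq, List.getD_eq_getElem?_getD]
  cases h : w[n % w.length]? with
  | none => simp
  | some d => exact hw d (List.mem_of_getElem? h)

lemma prePer_mem {p w : List ℕ} (hp : ∀ d ∈ p, 1 ≤ d ∧ d ≤ 2) (hw : ∀ d ∈ w, 1 ≤ d ∧ d ≤ 2)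
    (n : ℕ) : 1 ≤ prePer p w n ∧ prePer p w n ≤ 2 := by
  rw [prePer, catSeq]
  split_ifs with h
  · rw [List.getD_eq_getElem _ _ h]
    exact hp _ (List.getElem_mem h)
  · exact perSeq_mem hw _

lemma rho_mem (n : ℤ) : 1 ≤ rho n ∧ rho n ≤ 2 := by
  rw [rho]
  split_ifs
  · exact perSeq_mem (by decide) _
  · exact prePer_mem (by decide) (by decide) _

lemma rho_eq_of_emod_nine {m n : ℤ} (hm : 0 ≤ m) (hn : 0 ≤ n) (h : m % 9 = n % 9) :
    rho m = rho n := by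
  rw [rho, rho, if_pos hm, if_pos hn, perSeq, perSeq]
  congr 1
  simp only [List.length_cons, List.length_nil]
  omega

lemma rho_eq_of_emod_six {m n : ℤ} (hm : m ≤ -19) (hn : n ≤ -19) (h : m % 6 = n % 6) :
    rho m = rho n := by
  rw [rho, rho, if_neg (by omega), if_neg (by omega), prePer, catSeq, catSeq,
    if_neg (by simp; omega), if_neg (by simp; omega), perSeq, perSeq]
  congr 1
  simp only [List.length_cons, List.length_nil]
  omega

lemma lamUpper_rho_lt_of_mem :
    ∀ j ∈ Finset.Icc (-45 : ℤ) 28, j ≠ 0 → lamUpper rho 20 j < lamLower rho 20 0 := by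
  decide +kernel

lemma lamUpper_rho_lt {j : ℤ} (hj : j ≠ 0) : lamUpper rho 20 j < lamLower rho 20 0 := by
  by_cases h1 : 28 < j
  · rw [lamUpper_congr (k := 20 + (j - 20) % 9) fun i hi hi' =>
      rho_eq_of_emod_nine (by omega) (by omega) (by omega)]
    exact lamUpper_rho_lt_of_mem _ (by rw [Finset.mem_Icc]; omega) (by omega)
  by_cases h2 : j < -45
  · rw [lamUpper_congr (k := -40 - (-40 - j) % 6) fun i hi hi' =>
      rho_eq_of_emod_six (by omega) (by omega) (by omega)]
    exact lamUpper_rho_lt_of_mem _ (by rw [Finset.mem_Icc]; omega) (by omega)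
  exact lamUpper_rho_lt_of_mem j (by rw [Finset.mem_Icc]; omega) hj

lemma lam_rho_lt {j : ℤ} (hj : j ≠ 0) : lam rho j < lam rho 0 :=
  calc lam rho j ≤ lamUpper rho 20 j := lam_le_lamUpper rho_mem 20 j
    _ < lamLower rho 20 0 := by exact_mod_cast lamUpper_rho_lt hj
    _ ≤ lam rho 0 := lamLower_le_lam rho_mem 20 0

lemma lam_rho_zero : lam rho 0 = fV := by
  rw [lam, fV]
  congr 2
  · ext n
    rw [rho, if_pos (by omega)]
    congr 1
    omega
  · ext n
    rw [rho, if_neg (by omega)]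
    congr 1
    omega

lemma isGreatest_lam_rho : IsGreatest (range (lam rho)) (lam rho 0) := by
  refine ⟨mem_range_self 0, ?_⟩
  rintro _ ⟨j, rfl⟩
  rcases eq_or_ne j 0 with rfl | hj
  · exact le_rfl
  · exact (lam_rho_lt hj).le

/-- `λ_j(ρ) < λ_0(ρ)` for `j ≠ 0`; consequently
`m(ρ) = λ_0(ρ) = f ∈ M`. -/
theorem f_in_M :
    (∀ j : ℤ, j ≠ 0 → lam rho j < lam rho 0) ∧
    markovVal rho = lam rho 0 ∧ lam rho 0 = fV ∧ fV ∈ MarkovSpectrum := by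
  have h : markovVal rho = lam rho 0 := isGreatest_lam_rho.csSup_eq
  exact ⟨fun j hj => lam_rho_lt hj, h, lam_rho_zero, rho, fun n => (rho_mem n).1,
    isGreatest_lam_rho.bddAbove, (h.trans lam_rho_zero).symm⟩
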